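/- arXiv:1704.02505 — 5 statements merged into one kernel-verified Lean document; each statement's English description precedes it below -/
import Mathlib

section
/- Let d < n be positive integers, let σ be a real d×n matrix of rank d, let C = Im σᵀ ⊆ ℝⁿ, and let Π and Π^⊥ denote the orthogonal projections of ℝⁿ onto C and onto C^⊥ = Ker σ, respectively. Let h > 0, z ∈ ℝⁿ, ξ ∈ C, and let ϑ ∈ ℝⁿ satisfy ‖ξ + Π(ϑ)‖ < h. Then the vector φ̄(ϑ) := Π(z) + ‖Π^⊥(z)‖ (h² − ‖ξ + Π(ϑ)‖²)^{−1/2} (ξ + Π(ϑ)) lies in C and is the unique maximizer over C of the function φ ↦ F(φ,ϑ) := ⟨ξ, φ⟩ − ⟨ϑ, z − φ⟩ − h‖z − φ‖, and the maximal value equals G(ϑ) := −⟨Π^⊥(ϑ), Π^⊥(z)⟩ + ⟨ξ, Π(z)⟩ − (h² − ‖ξ + Π(ϑ)‖²)^{1/2} ‖Π^⊥(z)‖. -/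
open Matrix
open scoped RealInnerProductSpace

theorem stmt0 {d n : ℕ} (hd : 0 < d) (hdn : d < n)
    (σ : Matrix (Fin d) (Fin n) ℝ) (hrank : σ.rank = d)
    (h : ℝ) (hh : 0 < h)
    (z ξ ϑ : EuclideanSpace ℝ (Fin n))
    (C : Submodule ℝ (EuclideanSpace ℝ (Fin n)))
    (hC : C = LinearMap.range (Matrix.toEuclideanLin σᵀ))
    (hξ : ξ ∈ C)
    (Pj Pjp : EuclideanSpace ℝ (Fin n) → EuclideanSpace ℝ (Fin n))
    (hPj : ∀ x, Pj x = (Submodule.orthogonalProjection C x : EuclideanSpace ℝ (Fin n)))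
    (hPjp : ∀ x, Pjp x = x - Pj x)
    (F : EuclideanSpace ℝ (Fin n) → EuclideanSpace ℝ (Fin n) → ℝ)
    (hF : ∀ φ θ, F φ θ = ⟪ξ, φ⟫ - ⟪θ, z - φ⟫ - h * ‖z - φ‖)
    (hbound : ‖ξ + Pj ϑ‖ < h)
    (φbar : EuclideanSpace ℝ (Fin n))
    (hφbar : φbar = Pj z
        + (‖Pjp z‖ * (Real.sqrt (h ^ 2 - ‖ξ + Pj ϑ‖ ^ 2))⁻¹) • (ξ + Pj ϑ)) :
    φbar ∈ C ∧
    (∀ φ ∈ C, F φ ϑ ≤ F φbar ϑ) ∧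
    (∀ φ ∈ C, F φ ϑ = F φbar ϑ → φ = φbar) ∧
    F φbar ϑ =
      -⟪Pjp ϑ, Pjp z⟫ + ⟪ξ, Pj z⟫ - Real.sqrt (h ^ 2 - ‖ξ + Pj ϑ‖ ^ 2) * ‖Pjp z‖ := by
  have hPC : ∀ x, Pj x ∈ C := fun x => by rw [hPj]; exact Submodule.coe_mem _
  have hort : ∀ x, ∀ c ∈ C, ⟪Pjp x, c⟫ = 0 := fun x c hc => by
    rw [hPjp, hPj]
    exact Submodule.starProjection_inner_eq_zero x c hc
  have hvC : ξ + Pj ϑ ∈ C := C.add_mem hξ (hPC ϑ)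
  obtain ⟨v, hv⟩ : ∃ v, v = ξ + Pj ϑ := ⟨_, rfl⟩
  rw [← hv] at hvC hbound hφbar ⊢
  have hpos : 0 < h ^ 2 - ‖v‖ ^ 2 := by nlinarith [norm_nonneg v]
  obtain ⟨s, hs⟩ : ∃ s, s = Real.sqrt (h ^ 2 - ‖v‖ ^ 2) := ⟨_, rfl⟩
  have hs0 : 0 < s := by rw [hs]; exact Real.sqrt_pos.2 hpos
  have hs2 : s ^ 2 = h ^ 2 - ‖v‖ ^ 2 := by rw [hs]; exact Real.sq_sqrt hpos.le
  rw [← hs] at hφbar ⊢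
  obtain ⟨b, hb⟩ : ∃ b, b = ‖Pjp z‖ := ⟨_, rfl⟩
  have hb0 : 0 ≤ b := by rw [hb]; exact norm_nonneg _
  rw [← hb] at hφbar ⊢
  have key : ∀ u ∈ C, ‖z - (Pj z + u)‖ ^ 2 = b ^ 2 + ‖u‖ ^ 2 ∧
      F (Pj z + u) ϑ = -⟪Pjp ϑ, Pjp z⟫ + ⟪ξ, Pj z⟫ + ⟪v, u⟫ - h * ‖z - (Pj z + u)‖ := by
    intro u hu
    have e : z - (Pj z + u) = Pjp z - u := by rw [hPjp]; abel
    constructor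
    · rw [e, norm_sub_sq_real, hort z u hu, hb]; ring
    · rw [hF, e]
      have h1 : ⟪ϑ, Pjp z - u⟫ = ⟪Pjp ϑ, Pjp z⟫ - ⟪Pj ϑ, u⟫ := by
        have e2 : ϑ = Pjp ϑ + Pj ϑ := by rw [hPjp]; abel
        have h2 := hort ϑ u hu
        have h3 := hort z (Pj ϑ) (hPC ϑ)
        rw [real_inner_comm] at h3
        conv_lhs => rw [e2]
        rw [inner_add_left, inner_sub_right, inner_sub_right, h2, h3]; ring
      rw [h1, hv, inner_add_right, inner_add_left]; ring
  have ineq : ∀ u : EuclideanSpace ℝ (Fin n), ∀ N : ℝ, 0 ≤ N → N ^ 2 = b ^ 2 + ‖u‖ ^ 2 →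
      (h * N) ^ 2 - (⟪v, u⟫ + s * b) ^ 2 =
        (‖v‖ ^ 2 * ‖u‖ ^ 2 - ⟪v, u⟫ ^ 2) + ‖b • v - s • u‖ ^ 2 := by
    intro u N _ hN
    rw [norm_sub_sq_real, norm_smul, norm_smul, real_inner_smul_left, real_inner_smul_right,
      mul_pow, mul_pow, mul_pow, hN, Real.norm_eq_abs, Real.norm_eq_abs, sq_abs, sq_abs]
    have : h ^ 2 = s ^ 2 + ‖v‖ ^ 2 := by linarith
    rw [this]; ring
  have cs : ∀ u : EuclideanSpace ℝ (Fin n), 0 ≤ ‖v‖ ^ 2 * ‖u‖ ^ 2 - ⟪v, u⟫ ^ 2 := by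
    intro u
    have := real_inner_mul_inner_self_le v u
    rw [real_inner_self_eq_norm_sq, real_inner_self_eq_norm_sq] at this
    nlinarith
  have hcC : (b * s⁻¹) • v ∈ C := C.smul_mem _ hvC
  have hval : F φbar ϑ = -⟪Pjp ϑ, Pjp z⟫ + ⟪ξ, Pj z⟫ - s * b := by
    obtain ⟨k1, k2⟩ := key _ hcC
    have hN : ‖z - (Pj z + (b * s⁻¹) • v)‖ = b * s⁻¹ * h := by
      rw [← sq_eq_sq₀ (norm_nonneg _) (by positivity), k1, norm_smul, mul_pow,
        Real.norm_eq_abs, sq_abs]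
      have : h ^ 2 = s ^ 2 + ‖v‖ ^ 2 := by linarith
      rw [mul_pow _ h, this]; field_simp
    rw [hφbar, k2, hN, real_inner_smul_right, real_inner_self_eq_norm_sq]
    have : ‖v‖ ^ 2 = h ^ 2 - s ^ 2 := by linarith
    rw [this]; field_simp; ring
  refine ⟨by rw [hφbar]; exact C.add_mem (hPC z) hcC, ?_, ?_, hval⟩
  · intro φ hφ
    obtain ⟨k1, k2⟩ := key (φ - Pj z) (C.sub_mem hφ (hPC z))
    have i := ineq _ _ (norm_nonneg _) k1
    have c := cs (φ - Pj z)
    rw [add_sub_cancel] at k1 k2 i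
    rw [hval, k2]
    have := abs_le_of_sq_le_sq' (a := ⟪v, φ - Pj z⟫ + s * b) (b := h * ‖z - φ‖)
      (by nlinarith [sq_nonneg ‖b • v - s • (φ - Pj z)‖]) (by positivity)
    linarith [this.2]
  · intro φ hφ heq
    obtain ⟨k1, k2⟩ := key (φ - Pj z) (C.sub_mem hφ (hPC z))
    have i := ineq _ _ (norm_nonneg _) k1
    have c := cs (φ - Pj z)
    rw [add_sub_cancel] at k1 k2 i
    rw [hval, k2] at heq
    have e : h * ‖z - φ‖ = ⟪v, φ - Pj z⟫ + s * b := by linarith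
    rw [e, sub_self] at i
    have n0 : ‖b • v - s • (φ - Pj z)‖ ^ 2 = 0 := by
      nlinarith [sq_nonneg ‖b • v - s • (φ - Pj z)‖]
    have n1 : b • v = s • (φ - Pj z) := by
      rw [← sub_eq_zero, ← norm_eq_zero]
      exact pow_eq_zero_iff (two_ne_zero) |>.1 n0
    rw [hφbar, mul_comm, mul_smul, n1, smul_smul, inv_mul_cancel₀ hs0.ne', one_smul]
    abel
end

section
/- Let d < n be positive integers, let σ be a real d×n matrix of rank d, let C = Im σᵀ ⊆ ℝⁿ, Π the orthogonal projection onto C, Π^⊥ = id − Π, h > 0, z ∈ ℝⁿ, ξ ∈ C, and let U ⊆ ℝⁿ be a nonempty convex compact set with ‖ξ + Π(ϑ)‖ < h for all ϑ ∈ U. Define F(φ,ϑ) = ⟨ξ, φ⟩ − ⟨ϑ, z − φ⟩ − h‖z − φ‖ and G(ϑ) = −⟨Π^⊥(ϑ), Π^⊥(z)⟩ + ⟨ξ, Π(z)⟩ − (h² − ‖ξ + Π(ϑ)‖²)^{1/2}‖Π^⊥(z)‖. Then the minmax identity inf_{ϑ ∈ U} sup_{φ ∈ C} F(φ,ϑ)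 = sup_{φ ∈ C} inf_{ϑ ∈ U} F(φ,ϑ) holds, both values are finite, and they equal G(ϑ̄) for any minimizer ϑ̄ of G over U (such a minimizer exists). -/
open Matrix
open scoped RealInnerProductSpace

theorem stmt1 {d n : ℕ} (hd : 0 < d) (hdn : d < n)
    (σ : Matrix (Fin d) (Fin n) ℝ) (hrank : σ.rank = d)
    (h : ℝ) (hh : 0 < h)
    (z ξ : EuclideanSpace ℝ (Fin n))
    (C : Submodule ℝ (EuclideanSpace ℝ (Fin n)))
    (hC : C = LinearMap.range (Matrix.toEuclideanLin σᵀ))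
    (hξ : ξ ∈ C)
    (Pj Pjp : EuclideanSpace ℝ (Fin n) → EuclideanSpace ℝ (Fin n))
    (hPj : ∀ x, Pj x = (Submodule.orthogonalProjectionOnto C x : EuclideanSpace ℝ (Fin n)))
    (hPjp : ∀ x, Pjp x = x - Pj x)
    (U : Set (EuclideanSpace ℝ (Fin n))) (hUne : U.Nonempty)
    (hUconv : Convex ℝ U) (hUcomp : IsCompact U)
    (hUbound : ∀ ϑ ∈ U, ‖ξ + Pj ϑ‖ < h)
    (F : EuclideanSpace ℝ (Fin n) → EuclideanSpace ℝ (Fin n) → ℝ)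
    (hF : ∀ φ θ, F φ θ = ⟪ξ, φ⟫ - ⟪θ, z - φ⟫ - h * ‖z - φ‖)
    (G : EuclideanSpace ℝ (Fin n) → ℝ)
    (hG : ∀ ϑ, G ϑ = -⟪Pjp ϑ, Pjp z⟫ + ⟪ξ, Pj z⟫
        - Real.sqrt (h ^ 2 - ‖ξ + Pj ϑ‖ ^ 2) * ‖Pjp z‖) :
    (∃ ϑbar ∈ U, ∀ ϑ ∈ U, G ϑbar ≤ G ϑ) ∧
    ∀ ϑbar ∈ U, (∀ ϑ ∈ U, G ϑbar ≤ G ϑ) →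
      (⨅ ϑ : U, ⨆ φ : C, ((F (φ : EuclideanSpace ℝ (Fin n))
          (ϑ : EuclideanSpace ℝ (Fin n)) : ℝ) : EReal)) = (G ϑbar : ℝ) ∧
      (⨆ φ : C, ⨅ ϑ : U, ((F (φ : EuclideanSpace ℝ (Fin n))
          (ϑ : EuclideanSpace ℝ (Fin n)) : ℝ) : EReal)) = (G ϑbar : ℝ) := by
  have hmem : ∀ x, Pj x ∈ C := fun x => by rw [hPj]; exact Subtype.property _
  have hadd : ∀ x y, Pj (x + y) = Pj x + Pj y := fun x y => by simp [hPj]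
  have hsmul : ∀ (t : ℝ) x, Pj (t • x) = t • Pj x := fun t x => by simp [hPj]
  have hsub : ∀ x y, Pj (x - y) = Pj x - Pj y := fun x y => by simp [hPj]
  have hcont : Continuous Pj := by
    have : Pj = fun x => (Submodule.orthogonalProjectionOnto C x : EuclideanSpace ℝ (Fin n)) :=
      funext hPj
    rw [this]; fun_prop
  have horth : ∀ u ∈ C, ∀ v, ⟪u, Pjp v⟫ = 0 := by
    intro u hu v
    rw [hPjp, hPj, real_inner_comm]
    exact C.starProjection_inner_eq_zero v u hu
  have hadd2 : ∀ x y, Pjp (x + y) = Pjp x + Pjp y := fun x y => by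
    rw [hPjp, hPjp, hPjp, hadd]; abel
  have hsmul2 : ∀ (t : ℝ) x, Pjp (t • x) = t • Pjp x := fun t x => by
    rw [hPjp, hPjp, hsmul, smul_sub]
  have hcont2 : Continuous Pjp := by
    have : Pjp = fun x => x - Pj x := funext hPjp
    rw [this]; fun_prop
  have hGc : Continuous G := by
    have : G = fun ϑ => -⟪Pjp ϑ, Pjp z⟫ + ⟪ξ, Pj z⟫
        - Real.sqrt (h ^ 2 - ‖ξ + Pj ϑ‖ ^ 2) * ‖Pjp z‖ := funext hG
    rw [this]; fun_prop
  -- F in terms of ψ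
  have hnorm : ∀ ψ ∈ C, ‖ψ + Pjp z‖ ^ 2 = ‖ψ‖ ^ 2 + ‖Pjp z‖ ^ 2 := by
    intro ψ hψ
    rw [norm_add_sq_real, horth ψ hψ]; ring
  have hFψ : ∀ ψ ∈ C, ∀ θ, F (Pj z - ψ) θ =
      ⟪ξ, Pj z⟫ - ⟪ξ + Pj θ, ψ⟫ - ⟪Pjp θ, Pjp z⟫ - h * ‖ψ + Pjp z‖ := by
    intro ψ hψ θ
    have e1 : z - (Pj z - ψ) = ψ + Pjp z := by rw [hPjp]; abel
    have e2 : θ = Pj θ + Pjp θ := by rw [hPjp]; abel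
    have e3 : ⟪θ, ψ + Pjp z⟫ = ⟪Pj θ, ψ⟫ + ⟪Pjp θ, Pjp z⟫ := by
      conv_lhs => rw [e2]
      rw [inner_add_left, inner_add_right, inner_add_right, horth _ (hmem θ),
        real_inner_comm, real_inner_comm ψ (Pjp θ)]
      rw [horth ψ hψ, real_inner_comm]; ring
    rw [hF, e1, e3, inner_sub_right, inner_add_left]; ring
  have hs : ∀ θ ∈ U, 0 < h ^ 2 - ‖ξ + Pj θ‖ ^ 2 := by
    intro θ hθ
    nlinarith [hUbound θ hθ, norm_nonneg (ξ + Pj θ)]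
  have hA : ∀ φ ∈ C, ∀ θ ∈ U, F φ θ ≤ G θ := by
    intro φ hφ θ hθ
    have hψ : Pj z - φ ∈ C := C.sub_mem (hmem z) hφ
    have e := hFψ _ hψ θ
    rw [sub_sub_cancel] at e
    rw [e, hG]
    set ψ := Pj z - φ
    have h1 := hnorm ψ hψ
    have h2 := Real.sq_sqrt (hs θ hθ).le
    have h3 := Real.sqrt_nonneg (h ^ 2 - ‖ξ + Pj θ‖ ^ 2)
    set s := Real.sqrt (h ^ 2 - ‖ξ + Pj θ‖ ^ 2)
    have h4 := neg_le_of_abs_le (abs_real_inner_le_norm (ξ + Pj θ) ψ)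
    have h5 : ‖ξ + Pj θ‖ * ‖ψ‖ + s * ‖Pjp z‖ ≤ h * ‖ψ + Pjp z‖ := by
      apply (pow_le_pow_iff_left₀ (by positivity) (by positivity) two_ne_zero).1
      have : (h * ‖ψ + Pjp z‖) ^ 2 = (‖ξ + Pj θ‖ ^ 2 + s ^ 2) * (‖ψ‖ ^ 2 + ‖Pjp z‖ ^ 2) := by
        rw [mul_pow, h1, h2]; ring
      rw [this]
      nlinarith [sq_nonneg (‖ξ + Pj θ‖ * ‖Pjp z‖ - s * ‖ψ‖)]
    linarith
  refine ⟨?_, ?_⟩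
  · obtain ⟨x, hx, hm⟩ := hUcomp.exists_isMinOn hUne hGc.continuousOn
    exact ⟨x, hx, fun y hy => hm hy⟩
  intro θ₀ hθ₀ hmin
  have hB : ∃ φ ∈ C, ∀ θ ∈ U, G θ₀ ≤ F φ θ := by
    have hs0 := Real.sqrt_pos.2 (hs θ₀ hθ₀)
    have hs2 := Real.sq_sqrt (hs θ₀ hθ₀).le
    set a := ξ + Pj θ₀ with ha
    set s := Real.sqrt (h ^ 2 - ‖a‖ ^ 2) with hsdef
    have haC : a ∈ C := C.add_mem hξ (hmem _)
    set W := ‖Pjp z‖ with hW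
    have hW0 : 0 ≤ W := norm_nonneg _
    have hψ : (-(W / s)) • a ∈ C := C.smul_mem _ haC
    refine ⟨Pj z - (-(W / s)) • a, C.sub_mem (hmem z) hψ, ?_⟩
    intro θ hθ
    rw [hFψ _ hψ, hG θ₀, ← ha, ← hsdef]
    have hN : ‖(-(W / s)) • a + Pjp z‖ = W * h / s := by
      apply (sq_eq_sq₀ (norm_nonneg _) (by positivity)).1
      rw [hnorm _ hψ, norm_smul, mul_pow, Real.norm_eq_abs, sq_abs]
      field_simp
      linear_combination W ^ 2 * hs2
    rw [hN, inner_smul_right]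
    -- first order condition
    set b := Pj (θ - θ₀) with hb
    set c := -⟪Pjp (θ - θ₀), Pjp z⟫ with hc
    have hq : ∀ t : ℝ, 0 < t → t ≤ 1 →
        0 ≤ c * (Real.sqrt (h ^ 2 - ‖a + t • b‖ ^ 2) + s) + W * (2 * ⟪a, b⟫ + t * ‖b‖ ^ 2) := by
      intro t ht ht1
      have hmemU : θ₀ + t • (θ - θ₀) ∈ U := hUconv.add_smul_sub_mem hθ₀ hθ ⟨ht.le, ht1⟩
      have hp := hs _ hmemU
      have hm := hmin _ hmemU
      have e : ξ + Pj (θ₀ + t • (θ - θ₀)) = a + t • b := by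
        rw [hadd, hsmul, ha, hb]; abel
      rw [hG θ₀, hG, e, ← ha, ← hsdef, hadd2, hsmul2, inner_add_left,
        real_inner_smul_left] at hm
      rw [e] at hp
      have hr2 := Real.sq_sqrt hp.le
      have hr0 := Real.sqrt_pos.2 hp
      set r := Real.sqrt (h ^ 2 - ‖a + t • b‖ ^ 2)
      have hexp : ‖a + t • b‖ ^ 2 = ‖a‖ ^ 2 + t * (2 * ⟪a, b⟫ + t * ‖b‖ ^ 2) := by
        rw [norm_add_sq_real, inner_smul_right, norm_smul, mul_pow, Real.norm_eq_abs, sq_abs]; ring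
      have h1 : 0 ≤ t * c + (s - r) * W := by rw [hc]; linarith
      have h2 : 0 ≤ (t * c + (s - r) * W) * (r + s) := by positivity
      have h3 : (t * c + (s - r) * W) * (r + s)
          = t * (c * (r + s) + W * (2 * ⟪a, b⟫ + t * ‖b‖ ^ 2)) := by
        linear_combination W * (hs2 - hr2 + hexp)
      rw [h3] at h2
      exact nonneg_of_mul_nonneg_right h2 ht
    have hlim : 0 ≤ c * (Real.sqrt (h ^ 2 - ‖a + (0:ℝ) • b‖ ^ 2) + s)
        + W * (2 * ⟪a, b⟫ + (0:ℝ) * ‖b‖ ^ 2) := by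
      have hct : Continuous fun t : ℝ => c * (Real.sqrt (h ^ 2 - ‖a + t • b‖ ^ 2) + s)
        + W * (2 * ⟪a, b⟫ + t * ‖b‖ ^ 2) := by fun_prop
      refine ge_of_tendsto ((hct.tendsto 0).mono_left (nhdsWithin_le_nhds (s := Set.Ioi 0))) ?_
      filter_upwards [Ioc_mem_nhdsGT (zero_lt_one' ℝ)] with t ht
      exact hq t ht.1 ht.2
    rw [zero_smul, add_zero, zero_mul, add_zero, ← hsdef] at hlim
    have hD : 0 ≤ c * s + W * ⟪a, b⟫ := by linarith
    have hD2 : 0 ≤ (c * s + W * ⟪a, b⟫) / s := by positivity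
    have e1 : ξ + Pj θ = a + b := by rw [ha, hb, hsub]; abel
    have e2 : Pjp θ = Pjp θ₀ + Pjp (θ - θ₀) := by rw [← hadd2]; congr 1; abel
    rw [e1, e2, inner_add_left a b, inner_add_left (Pjp θ₀), real_inner_self_eq_norm_sq, real_inner_comm a b]
    have h5 : (c * s + W * ⟪a, b⟫) / s = 
      W / s * (‖a‖ ^ 2 + ⟪a, b⟫) + c - h * (W * h / s) + s * W := by
      field_simp
      linear_combination (-W) * hs2
    rw [h5] at hD2
    rw [hc] at hD2
    linarith
  obtain ⟨φ, hφ, hφB⟩ := hB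
  have k1 : (⨅ ϑ : U, ⨆ φ : C, ((F (φ : EuclideanSpace ℝ (Fin n))
          (ϑ : EuclideanSpace ℝ (Fin n)) : ℝ) : EReal)) ≤ (G θ₀ : ℝ) :=
    iInf_le_of_le ⟨θ₀, hθ₀⟩ (iSup_le fun ψ => EReal.coe_le_coe_iff.2 (hA _ ψ.2 _ hθ₀))
  have k2 : ((G θ₀ : ℝ) : EReal) ≤ (⨆ φ : C, ⨅ ϑ : U, ((F (φ : EuclideanSpace ℝ (Fin n))
          (ϑ : EuclideanSpace ℝ (Fin n)) : ℝ) : EReal)) :=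
    le_iSup_of_le ⟨φ, hφ⟩ (le_iInf fun θ => EReal.coe_le_coe_iff.2 (hφB _ θ.2))
  have k3 := iSup_iInf_le_iInf_iSup (fun (φ : C) (ϑ : U) =>
    ((F (φ : EuclideanSpace ℝ (Fin n)) (ϑ : EuclideanSpace ℝ (Fin n)) : ℝ) : EReal))
  exact ⟨le_antisymm k1 (k2.trans k3), le_antisymm (k3.trans k1) k2⟩
end

section
/- Let d < n be positive integers, σ a real d×n matrix of rank d, C = Im σᵀ ⊆ ℝⁿ, Π the orthogonal projection onto C, Π^⊥ = id − Π, h > 0, z ∈ ℝⁿ, ξ ∈ C, and let U ⊆ ℝⁿ be a convex compact set containing 0 with ‖ξ + Π(ϑ)‖ < h for all ϑ ∈ U. Define F(φ,ϑ) = ⟨ξ, φ⟩ − ⟨ϑ, z − φ⟩ − h‖z − φ‖, G(ϑ) = −⟨Π^⊥(ϑ), Π^⊥(z)⟩ + ⟨ξ, Π(z)⟩ − (h² − ‖ξ + Π(ϑ)‖²)^{1/2}‖Π^⊥(z)‖, and φ̄(ϑ) = Π(z) + ‖Π^⊥(z)‖(h² − ‖ξ + Π(ϑ)‖²)^{−1/2}(ξ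 + Π(ϑ)). If ϑ̄ ∈ U is a minimizer of G over U, then F(φ̄(ϑ̄), ϑ̄) = inf_{ϑ ∈ U} F(φ̄(ϑ̄), ϑ); in particular (φ̄(ϑ̄), ϑ̄) is a saddle point of F on C × U. -/
open Matrix
open scoped RealInnerProductSpace

theorem aux_limit (a w k E r : ℝ) (hr : 0 < r)
    (H : ∀ t : ℝ, 0 < t → t ≤ 1 → 0 ≤ r - 2 * t * k - t ^ 2 * E ∧
      0 ≤ t * a + w * (Real.sqrt r - Real.sqrt (r - 2 * t * k - t ^ 2 * E))) :
    0 ≤ a + w * k * (Real.sqrt r)⁻¹ := by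
  have hs : 0 < Real.sqrt r := Real.sqrt_pos.mpr hr
  have hc : ContinuousAt (fun t : ℝ => a + w * (2 * k + t * E) /
      (Real.sqrt r + Real.sqrt (r - 2 * t * k - t ^ 2 * E))) 0 := by
    apply ContinuousAt.add continuousAt_const
    apply ContinuousAt.div
    · fun_prop
    · fun_prop
    · positivity
  have hl := hc.tendsto.mono_left (nhdsWithin_le_nhds (s := Set.Ioi 0))
  have h0 := ge_of_tendsto (b := 0) hl (by
    filter_upwards [Ioc_mem_nhdsGT (zero_lt_one (α := ℝ))] with t ht
    obtain ⟨h1, h2⟩ := H t ht.1 ht.2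
    have ht0 := ht.1
    set S := Real.sqrt (r - 2 * t * k - t ^ 2 * E) with hS
    have hS0 : 0 ≤ S := Real.sqrt_nonneg _
    have hS2 : S ^ 2 = r - 2 * t * k - t ^ 2 * E := Real.sq_sqrt h1
    have hr2 : Real.sqrt r ^ 2 = r := Real.sq_sqrt hr.le
    have hp : 0 < Real.sqrt r + S := by positivity
    have e : t * (a + w * (2 * k + t * E) / (Real.sqrt r + S))
        = t * a + w * (Real.sqrt r - S) := by
      field_simp
      linear_combination w * hS2 - w * hr2
    rw [← e] at h2
    exact nonneg_of_mul_nonneg_right h2 ht0)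
  have e : a + w * k * (Real.sqrt r)⁻¹ = a + w * (2 * k + 0 * E) /
      (Real.sqrt r + Real.sqrt (r - 2 * 0 * k - 0 ^ 2 * E)) := by
    simp only [mul_zero, zero_mul, sub_zero, add_zero, ne_eq, OfNat.ofNat_ne_zero,
      not_false_eq_true, zero_pow]
    field_simp
    ring
  rw [e]
  exact h0

theorem stmt2 {d n : ℕ} (hd : 0 < d) (hdn : d < n)
    (σ : Matrix (Fin d) (Fin n) ℝ) (hrank : σ.rank = d)
    (h : ℝ) (hh : 0 < h)
    (z ξ : EuclideanSpace ℝ (Fin n))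
    (C : Submodule ℝ (EuclideanSpace ℝ (Fin n)))
    (hC : C = LinearMap.range (Matrix.toEuclideanLin σᵀ))
    (hξ : ξ ∈ C)
    (Pj Pjp : EuclideanSpace ℝ (Fin n) → EuclideanSpace ℝ (Fin n))
    (hPj : ∀ x, Pj x = (Submodule.orthogonalProjectionOnto C x : EuclideanSpace ℝ (Fin n)))
    (hPjp : ∀ x, Pjp x = x - Pj x)
    (U : Set (EuclideanSpace ℝ (Fin n))) (hU0 : (0 : EuclideanSpace ℝ (Fin n)) ∈ U)
    (hUconv : Convex ℝ U) (hUcomp : IsCompact U)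
    (hUbound : ∀ ϑ ∈ U, ‖ξ + Pj ϑ‖ < h)
    (F : EuclideanSpace ℝ (Fin n) → EuclideanSpace ℝ (Fin n) → ℝ)
    (hF : ∀ φ θ, F φ θ = ⟪ξ, φ⟫ - ⟪θ, z - φ⟫ - h * ‖z - φ‖)
    (G : EuclideanSpace ℝ (Fin n) → ℝ)
    (hG : ∀ ϑ, G ϑ = -⟪Pjp ϑ, Pjp z⟫ + ⟪ξ, Pj z⟫
        - Real.sqrt (h ^ 2 - ‖ξ + Pj ϑ‖ ^ 2) * ‖Pjp z‖)
    (ϑbar : EuclideanSpace ℝ (Fin n)) (hϑbarU : ϑbar ∈ U)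
    (hϑbarmin : ∀ ϑ ∈ U, G ϑbar ≤ G ϑ)
    (φbar : EuclideanSpace ℝ (Fin n))
    (hφbar : φbar = Pj z
        + (‖Pjp z‖ * (Real.sqrt (h ^ 2 - ‖ξ + Pj ϑbar‖ ^ 2))⁻¹) • (ξ + Pj ϑbar)) :
    φbar ∈ C ∧
    IsLeast {x : ℝ | ∃ ϑ ∈ U, x = F φbar ϑ} (F φbar ϑbar) ∧
    (∀ φ ∈ C, F φ ϑbar ≤ F φbar ϑbar) := by
  have hPC : ∀ x, Pj x ∈ C := fun x => by rw [hPj]; exact Subtype.mem _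
  have horth : ∀ y ∈ C, ∀ x, ⟪y, Pjp x⟫ = 0 := by
    intro y hy x
    rw [hPjp, hPj]
    exact Submodule.inner_right_of_mem_orthogonal hy (Submodule.sub_starProjection_mem_orthogonal x)
  have horth' : ∀ y ∈ C, ∀ x, ⟪Pjp x, y⟫ = 0 := by
    intro y hy x
    rw [real_inner_comm]; exact horth y hy x
  have hdec : ∀ x, x = Pj x + Pjp x := fun x => by rw [hPjp]; abel
  set c := ξ + Pj ϑbar with hc
  have hcC : c ∈ C := C.add_mem hξ (hPC _)
  set q := Pjp z with hq
  have hch : ‖c‖ < h := hUbound _ hϑbarU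
  have hr : 0 < h ^ 2 - ‖c‖ ^ 2 := by nlinarith [norm_nonneg c]
  set s := Real.sqrt (h ^ 2 - ‖c‖ ^ 2) with hs
  have hs0 : 0 < s := Real.sqrt_pos.mpr hr
  have hs2 : s ^ 2 = h ^ 2 - ‖c‖ ^ 2 := Real.sq_sqrt hr.le
  have hw : 0 ≤ ‖q‖ := norm_nonneg q
  -- general formula for `F` on `C`
  have hnorm : ∀ y ∈ C, ‖z - (Pj z + y)‖ ^ 2 = ‖q‖ ^ 2 + ‖y‖ ^ 2 := by
    intro y hy
    have : z - (Pj z + y) = q - y := by rw [hq, hPjp]; abel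
    rw [this, norm_sub_sq_real, horth' y hy]; ring
  have hFC : ∀ y ∈ C, ∀ θ, F (Pj z + y) θ = ⟪ξ, Pj z⟫ - ⟪Pjp θ, q⟫ + ⟪ξ + Pj θ, y⟫
      - h * ‖z - (Pj z + y)‖ := by
    intro y hy θ
    have h1 : z - (Pj z + y) = q - y := by rw [hq, hPjp]; abel
    have h2 : ⟪θ, q - y⟫ = ⟪Pjp θ, q⟫ - ⟪Pj θ, y⟫ := by
      conv_lhs => rw [hdec θ]
      rw [inner_sub_right, inner_add_left, inner_add_left, horth _ (hPC θ), horth' y hy]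
      ring
    rw [hF]
    conv_lhs => rw [h1, h2]
    rw [h1, inner_add_right, inner_add_left]; ring
  set l := ‖q‖ * s⁻¹ with hl
  have hl0 : 0 ≤ l := by positivity
  have hls : l * s = ‖q‖ := by rw [hl]; field_simp
  have hyC : l • c ∈ C := C.smul_mem _ hcC
  have hnb : ‖z - (Pj z + l • c)‖ = l * h := by
    have h1 := hnorm _ hyC
    rw [norm_smul, Real.norm_of_nonneg hl0] at h1
    rw [← sq_eq_sq₀ (norm_nonneg _) (by positivity), h1, ← hls]
    linear_combination l ^ 2 * hs2
  refine ⟨?_, ⟨⟨ϑbar, hϑbarU, rfl⟩, ?_⟩, ?_⟩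
  · rw [hφbar]; exact C.add_mem (hPC _) hyC
  · rintro x ⟨ϑ, hϑ, rfl⟩
    have hadd : ∀ t : ℝ, Pj (ϑbar + t • (ϑ - ϑbar)) = Pj ϑbar + t • (Pj ϑ - Pj ϑbar) := by
      intro t; simp [hPj]
    have haddp : ∀ t : ℝ, Pjp (ϑbar + t • (ϑ - ϑbar)) = Pjp ϑbar + t • (Pjp ϑ - Pjp ϑbar) := by
      intro t; rw [hPjp, hadd, hPjp, hPjp]; module
    have key := aux_limit (-⟪Pjp ϑ - Pjp ϑbar, q⟫) ‖q‖ ⟪c, Pj ϑ - Pj ϑbar⟫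
      (‖Pj ϑ - Pj ϑbar‖ ^ 2) _ hr (by
        intro t ht0 ht1
        have hmem : ϑbar + t • (ϑ - ϑbar) ∈ U :=
          hUconv.add_smul_sub_mem hϑbarU hϑ ⟨ht0.le, ht1⟩
        have hb := hUbound _ hmem
        have hm := hϑbarmin _ hmem
        have he : ξ + Pj (ϑbar + t • (ϑ - ϑbar)) = c + t • (Pj ϑ - Pj ϑbar) := by
          rw [hadd, hc]; abel
        have hn : h ^ 2 - ‖c + t • (Pj ϑ - Pj ϑbar)‖ ^ 2 = h ^ 2 - ‖c‖ ^ 2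
            - 2 * t * ⟪c, Pj ϑ - Pj ϑbar⟫ - t ^ 2 * ‖Pj ϑ - Pj ϑbar‖ ^ 2 := by
          rw [norm_add_sq_real, inner_smul_right, norm_smul, Real.norm_of_nonneg ht0.le]; ring
        rw [he] at hb
        rw [← hn]
        refine ⟨by nlinarith [norm_nonneg (c + t • (Pj ϑ - Pj ϑbar))], ?_⟩
        rw [hG, hG, he, haddp, inner_add_left, inner_smul_left, ← hc, ← hs] at hm
        simp only [conj_trivial] at hm
        rw [← hs]
        linarith)
    rw [hφbar, hFC _ hyC, hFC _ hyC]
    have e2 : ξ + Pj ϑ = c + (Pj ϑ - Pj ϑbar) := by rw [hc]; abel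
    rw [e2, ← hc, inner_add_left c, inner_smul_right (Pj ϑ - Pj ϑbar), real_inner_comm c (Pj ϑ - Pj ϑbar)]
    rw [← hs, inner_sub_left] at key
    have : ‖q‖ * ⟪c, Pj ϑ - Pj ϑbar⟫ * s⁻¹ = l * ⟪c, Pj ϑ - Pj ϑbar⟫ := by rw [hl]; ring
    rw [this] at key
    first
      | linarith
      | (rw [real_inner_comm c (Pj ϑ - Pj ϑbar)] at key; linarith)
  · intro φ hφ
    have hyC' : φ - Pj z ∈ C := C.sub_mem hφ (hPC _)
    have e : φ = Pj z + (φ - Pj z) := by abel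
    generalize φ - Pj z = y at e hyC'
    subst e
    rw [hφbar, hFC _ hyC, hFC _ hyC', hnb, ← hc, inner_smul_right, real_inner_self_eq_norm_sq]
    have h1 := hnorm _ hyC'
    have h2 := real_inner_le_norm c y
    have h3 : ‖c‖ * ‖y‖ + s * ‖q‖ ≤ h * ‖z - (Pj z + y)‖ := by
      refine (fun a b => (abs_le_of_sq_le_sq' a b).2) ?_ ?_
      · rw [mul_pow, h1]
        have : h ^ 2 = s ^ 2 + ‖c‖ ^ 2 := by linarith
        rw [this]
        nlinarith [sq_nonneg (‖c‖ * ‖q‖ - s * ‖y‖)]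
      · positivity
    have h4 : l * ‖c‖ ^ 2 - h * (l * h) = - (s * ‖q‖) := by
      rw [← hls]; linear_combination l * hs2
    linarith
end

section
/- Let c be a symmetric positive definite real 2×2 matrix, a := c², and let σ = (s, 0) with s ≠ 0. Let Π^⊥ denote the orthogonal projection of ℝ² onto Ker(σ c). Then for every z = (z₁, z₂) ∈ ℝ², ‖Π^⊥(c z)‖ = √(a₁₁ a₂₂ − a₁₂²) · (a₁₁)^{−1/2} · |z₂|, where c z denotes the matrix-vector product and a₁₁, a₁₂, a₂₂ are the entries of a. -/
open Matrix

theorem stmt9 (c : Matrix (Fin 2) (Fin 2) ℝ) (hc : c.PosDef)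
    (a : Matrix (Fin 2) (Fin 2) ℝ) (ha : a = c * c)
    (s : ℝ) (hs : s ≠ 0)
    (σ : Matrix (Fin 1) (Fin 2) ℝ) (hσ : σ = Matrix.of ![![s, 0]]) :
    ∀ z : EuclideanSpace ℝ (Fin 2),
      ‖(Submodule.orthogonalProjectionOnto (LinearMap.ker (Matrix.toEuclideanLin (σ * c)))
          (Matrix.toEuclideanLin c z) : EuclideanSpace ℝ (Fin 2))‖
        = Real.sqrt (a 0 0 * a 1 1 - a 0 1 ^ 2) * (Real.sqrt (a 0 0))⁻¹ * |z 1| := by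
  intro z
  have hsym : c 1 0 = c 0 1 := by
    have h := hc.isHermitian.apply 0 1
    simpa using h
  have hp : 0 < c 0 0 := hc.diag_pos
  have hD : 0 < c 0 0 ^ 2 + c 0 1 ^ 2 := by positivity
  have hmem : ∀ x : EuclideanSpace ℝ (Fin 2),
      x ∈ LinearMap.ker (Matrix.toEuclideanLin (σ * c)) ↔ c 0 0 * x 0 + c 0 1 * x 1 = 0 := by
    intro x
    rw [LinearMap.mem_ker]
    have key : ∀ y : EuclideanSpace ℝ (Fin 1), y = 0 ↔ y 0 = 0 := by
      intro y
      constructor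
      · rintro rfl; rfl
      · intro h; ext i; fin_cases i; exact h
    rw [key]
    have : (Matrix.toEuclideanLin (σ * c) x) 0 = s * (c 0 0 * x 0 + c 0 1 * x 1) := by
      subst hσ
      simp [Matrix.toLpLin_apply, Matrix.mulVec, dotProduct, Fin.sum_univ_two, Matrix.vecMul]
      ring
    rw [this]
    simp [hs]
  set t : ℝ := (c 0 0 * c 1 1 - c 0 1 ^ 2) * z 1 / (c 0 0 ^ 2 + c 0 1 ^ 2) with ht
  have hcz0 : (Matrix.toEuclideanLin c z) 0 = c 0 0 * z 0 + c 0 1 * z 1 := by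
    simp [Matrix.toLpLin_apply, Matrix.mulVec, dotProduct, Fin.sum_univ_two]
  have hcz1 : (Matrix.toEuclideanLin c z) 1 = c 0 1 * z 0 + c 1 1 * z 1 := by
    simp [Matrix.toLpLin_apply, Matrix.mulVec, dotProduct, Fin.sum_univ_two, hsym]
  have hproj : (LinearMap.ker (Matrix.toEuclideanLin (σ * c))).starProjection
      (Matrix.toEuclideanLin c z) = !₂[-c 0 1 * t, c 0 0 * t] := by
    apply Submodule.eq_starProjection_of_mem_of_inner_eq_zero
    · rw [hmem]
      simp
      ring
    · intro w hw
      rw [hmem] at hw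
      simp only [PiLp.inner_apply, Fin.sum_univ_two, PiLp.sub_apply, hcz0, hcz1]
      simp
      have h1 : w 0 = -(c 0 1 * w 1) / c 0 0 := by
        field_simp
        linarith
      rw [h1, ht]
      field_simp
      ring
  have hn : (Submodule.orthogonalProjectionOnto (LinearMap.ker (Matrix.toEuclideanLin (σ * c)))
          (Matrix.toEuclideanLin c z) : EuclideanSpace ℝ (Fin 2)) = !₂[-c 0 1 * t, c 0 0 * t] := hproj
  rw [hn, EuclideanSpace.norm_eq]
  have e0 : a 0 0 = c 0 0 ^ 2 + c 0 1 ^ 2 := by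
    subst ha; simp [Matrix.mul_apply, Fin.sum_univ_two, hsym]; ring
  have e1 : a 0 0 * a 1 1 - a 0 1 ^ 2 = (c 0 0 * c 1 1 - c 0 1 ^ 2) ^ 2 := by
    subst ha; simp [Matrix.mul_apply, Fin.sum_univ_two, hsym]; ring
  rw [e1, e0, ← Real.sqrt_inv, ← Real.sqrt_sq_eq_abs (z 1), ← Real.sqrt_mul (by positivity),
    ← Real.sqrt_mul (by positivity)]
  congr 1
  simp [Fin.sum_univ_two]
  rw [ht]
  field_simp
  ring
end

section
/- Let c be a symmetric positive definite real 2×2 matrix, a := c², and let σ = (s, 0) with s ≠ 0. Let Π denote the orthogonal projection of ℝ² onto Im((σ c)ᵀ). Then for every z = (z₁, z₂) ∈ ℝ², c^{−1} Π(c z) = (z₁ + (a₁₂ / a₁₁) z₂, 0), where a₁₁, a₁₂ are the entries of a and c^{−1} is the matrix inverse of c. -/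
open Matrix

theorem stmt10 (c : Matrix (Fin 2) (Fin 2) ℝ) (hc : c.PosDef)
    (a : Matrix (Fin 2) (Fin 2) ℝ) (ha : a = c * c)
    (s : ℝ) (hs : s ≠ 0)
    (σ : Matrix (Fin 1) (Fin 2) ℝ) (hσ : σ = Matrix.of ![![s, 0]]) :
    ∀ z : EuclideanSpace ℝ (Fin 2),
      (Matrix.toEuclideanLin c⁻¹
          (Submodule.orthogonalProjectionOnto (LinearMap.range (Matrix.toEuclideanLin (σ * c)ᵀ))
            (Matrix.toEuclideanLin c z) : EuclideanSpace ℝ (Fin 2))) 0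
        = z 0 + a 0 1 / a 0 0 * z 1 ∧
      (Matrix.toEuclideanLin c⁻¹
          (Submodule.orthogonalProjectionOnto (LinearMap.range (Matrix.toEuclideanLin (σ * c)ᵀ))
            (Matrix.toEuclideanLin c z) : EuclideanSpace ℝ (Fin 2))) 1 = 0 := by
  intro z
  have hsym : c 1 0 = c 0 1 := by
    have := hc.isHermitian.apply 0 1
    simpa using this
  have hdet : IsUnit c.det := hc.det_pos.ne'.isUnit
  have hpos : 0 < c 0 0 := hc.diag_pos
  have ha0 : a 0 0 = c 0 0 ^ 2 + c 0 1 ^ 2 := by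
    rw [ha, Matrix.mul_apply, Fin.sum_univ_two, hsym]; ring
  have ha1 : a 0 1 = c 0 0 * c 0 1 + c 0 1 * c 1 1 := by
    rw [ha, Matrix.mul_apply, Fin.sum_univ_two]
  have hne : c 0 0 ^ 2 + c 0 1 ^ 2 ≠ 0 := by positivity
  set t : ℝ := z 0 + a 0 1 / a 0 0 * z 1 with ht
  have ht2 : t * (c 0 0 ^ 2 + c 0 1 ^ 2)
      = z 0 * (c 0 0 ^ 2 + c 0 1 ^ 2) + (c 0 0 * c 0 1 + c 0 1 * c 1 1) * z 1 := by
    rw [ht, ha0, ha1]; field_simp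
  clear_value t
  have hproj : (Submodule.orthogonalProjectionOnto
      (LinearMap.range (Matrix.toEuclideanLin (σ * c)ᵀ))
      (Matrix.toEuclideanLin c z) : EuclideanSpace ℝ (Fin 2))
      = Matrix.toEuclideanLin c !₂[t, 0] := by
    rw [← Submodule.starProjection_apply]
    apply Submodule.eq_starProjection_of_mem_of_inner_eq_zero
    · refine ⟨!₂[t / s], ?_⟩
      ext i
      fin_cases i <;>
        simp [hσ, Matrix.toLpLin_apply, Matrix.mulVec, Matrix.vecMul, dotProduct,
          Fin.sum_univ_two, hsym] <;> field_simp
    · rintro _ ⟨y, rfl⟩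
      simp [hσ, Matrix.toLpLin_apply, Matrix.mulVec, Matrix.vecMul, dotProduct,
          Fin.sum_univ_two, hsym, PiLp.inner_apply]
      linear_combination (-(s * y 0)) * ht2
  have hinv : Matrix.toEuclideanLin c⁻¹ (Matrix.toEuclideanLin c !₂[t, 0]) = !₂[t, 0] := by
    simp only [Matrix.toLpLin_apply, Matrix.mulVec_mulVec, Matrix.nonsing_inv_mul c hdet,
      Matrix.one_mulVec]
  rw [hproj, hinv]
  simp
end
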